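/- arXiv:0812.2291 — 2 statements merged into one kernel-verified Lean document; each statement's English description precedes it below -/
import Mathlib

section
/- Let (A,P) be a normalized truthful mechanism for the MAB mechanism design problem such that A is a non-degenerate deterministic allocation rule. Then A is pointwise monotone. -/
open Finset

namespace MAB

/-- A realization of clicks: for each agent and each round, whether the agent
would be clicked if shown at that round. -/
abbrev Realization (k T : ℕ) := Fin k → Fin T → Bool

/-- A deterministic allocation rule: maps a bid profile, a realization and a round
to the agent chosen at that round. -/
abbrev Alloc (k T : ℕ) := (Fin k → ℝ) → Realization k T → Fin T → Fin k

/-- A payment rule: maps a bid profile and a realization to the payment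
charged to each agent. -/
abbrev Payment (k T : ℕ) := (Fin k → ℝ) → Realization k T → Fin k → ℝ

variable {k T : ℕ}

/-- A bid profile consists of positive reals. -/
def PosBids (b : Fin k → ℝ) : Prop := ∀ i, 0 < b i

/-- The allocation rule is online: the choice at round `t` is determined by the bids
and the bits observed at rounds `s < t`. -/
def Online (A : Alloc k T) : Prop :=
  ∀ (b : Fin k → ℝ) (ρ ρ' : Realization k T) (t : Fin T),
    (∀ s : Fin T, s < t → ρ (A b ρ s) s = ρ' (A b ρ s) s) → A b ρ t = A b ρ' t

/-- The click-allocation: the number of rounds in which agent `i` is chosen and clicked. -/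
def clicks (A : Alloc k T) (b : Fin k → ℝ) (ρ : Realization k T) (i : Fin k) : ℕ :=
  (univ.filter fun t : Fin T => A b ρ t = i ∧ ρ i t = true).card

/-- The payment rule only uses clicks actually observed by the allocation rule. -/
def PaymentObservable (A : Alloc k T) (P : Payment k T) : Prop :=
  ∀ (b : Fin k → ℝ) (ρ ρ' : Realization k T),
    (∀ t : Fin T, ρ (A b ρ t) t = ρ' (A b ρ t) t) → P b ρ = P b ρ'

/-- The mechanism is normalized: `0 ≤ P_i(b;ρ) ≤ b_i · C_i(b;ρ)`. -/
def Normalized (A : Alloc k T) (P : Payment k T) : Prop :=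
  ∀ (b : Fin k → ℝ) (ρ : Realization k T) (i : Fin k), PosBids b →
    0 ≤ P b ρ i ∧ P b ρ i ≤ b i * (clicks A b ρ i : ℝ)

/-- The mechanism is truthful: bidding the true value dominates any other bid. -/
def Truthful (A : Alloc k T) (P : Payment k T) : Prop :=
  ∀ (b : Fin k → ℝ) (ρ : Realization k T) (i : Fin k) (v : ℝ), PosBids b → 0 < v →
    v * (clicks A (Function.update b i v) ρ i : ℝ) - P (Function.update b i v) ρ i ≥
      v * (clicks A b ρ i : ℝ) - P b ρ i

/-- Pointwise monotonicity: an agent that is played keeps the impression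
after increasing her bid. -/
def PointwiseMonotone (A : Alloc k T) : Prop :=
  ∀ (b : Fin k → ℝ) (ρ : Realization k T) (t : Fin T) (i : Fin k) (x : ℝ),
    PosBids b → A b ρ t = i → b i < x → A (Function.update b i x) ρ t = i

/-- `flip ρ i t` is `ρ ⊕ 1(i,t)`: the realization with the bit of agent `i`
at round `t` flipped. -/
def flip (ρ : Realization k T) (i : Fin k) (t : Fin T) : Realization k T :=
  fun j s => if j = i ∧ s = t then !(ρ j s) else ρ j s

/-- Round `t` is `(b;ρ)`-influential. -/
def InfluentialAt (A : Alloc k T) (b : Fin k → ℝ) (ρ : Realization k T) (t : Fin T) : Prop :=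
  ∃ t' : Fin T, t < t' ∧ A b ρ t' ≠ A b (flip ρ (A b ρ t) t) t'

/-- Round `t` is influential for realization `ρ`. -/
def Influential (A : Alloc k T) (ρ : Realization k T) (t : Fin T) : Prop :=
  ∃ b : Fin k → ℝ, PosBids b ∧ InfluentialAt A b ρ t

/-- The allocation rule is exploration-separated: in any influential round
the allocation does not depend on the bids. -/
def ExplorationSeparated (A : Alloc k T) : Prop :=
  ∀ (ρ : Realization k T) (t : Fin T), Influential A ρ t →
    ∀ b b' : Fin k → ℝ, PosBids b → PosBids b' → A b ρ t = A b' ρ t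

/-- Round `t` is `(b;ρ)`-influential with influenced agent `i`. -/
def InfluencedAgent (A : Alloc k T) (b : Fin k → ℝ) (ρ : Realization k T) (t : Fin T)
    (i : Fin k) : Prop :=
  ∃ t' : Fin T, t < t' ∧ A b ρ t' ≠ A b (flip ρ (A b ρ t) t) t' ∧
    (i = A b ρ t' ∨ i = A b (flip ρ (A b ρ t) t) t')

/-- Round `t` is `(b;ρ)`-secured from agent `i`. -/
def SecuredFrom (A : Alloc k T) (b : Fin k → ℝ) (ρ : Realization k T) (t : Fin T)
    (i : Fin k) : Prop :=
  ∀ x : ℝ, b i < x → A (Function.update b i x) ρ t = A b ρ t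

/-- The allocation rule is weakly separated. -/
def WeaklySeparated (A : Alloc k T) : Prop :=
  ∀ (b : Fin k → ℝ) (ρ : Realization k T) (t : Fin T) (i : Fin k),
    PosBids b → InfluencedAgent A b ρ t i → SecuredFrom A b ρ t i

/-- Non-degeneracy of the allocation rule. -/
def NonDegenerate (A : Alloc k T) : Prop :=
  ∀ (b : Fin k → ℝ) (ρ : Realization k T) (t t' : Fin T), PosBids b → t ≤ t' →
    ∃ l u : ℝ, l < u ∧ l ≤ b (A b ρ t) ∧ b (A b ρ t) ≤ u ∧
      ∀ x ∈ Set.Icc l u, ∀ φ ∈ ({ρ, flip ρ (A b ρ t) t} : Set (Realization k T)),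
        ∀ s ∈ ({t, t'} : Set (Fin T)),
          (A (Function.update b (A b ρ t) x) φ s = A b ρ t ↔ A b φ s = A b ρ t)

/-- The allocation rule is scale-free. -/
def ScaleFree (A : Alloc k T) : Prop :=
  ∀ (c : ℝ) (b : Fin k → ℝ) (ρ : Realization k T) (t : Fin T), 0 < c → PosBids b →
    A (fun j => c * b j) ρ t = A b ρ t

/-- Independence of irrelevant alternatives. -/
def IIA (A : Alloc k T) : Prop :=
  ∀ (b : Fin k → ℝ) (ρ : Realization k T) (t : Fin T) (i : Fin k) (x : ℝ),
    PosBids b → 0 < x → A b ρ t ≠ A (Function.update b i x) ρ t →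
    (A b ρ t = i ∨ A (Function.update b i x) ρ t = i)

/-- Round `t` is bid-independent w.r.t. realization `ρ`. -/
def BidIndependent (A : Alloc k T) (ρ : Realization k T) (t : Fin T) : Prop :=
  ∀ b b' : Fin k → ℝ, PosBids b → PosBids b' → A b ρ t = A b' ρ t

/-- The probability of realization `ρ` when clicks are independent Bernoulli
with CTR vector `μ`. -/
noncomputable def prob (μ : Fin k → ℝ) (ρ : Realization k T) : ℝ :=
  ∏ i : Fin k, ∏ t : Fin T, if ρ i t then μ i else 1 - μ i

/-- A valid CTR vector: all entries in `[0,1]`. -/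
def ValidCTR (μ : Fin k → ℝ) : Prop := ∀ i, 0 ≤ μ i ∧ μ i ≤ 1

/-- A valid value profile: all values in `(0, vmax]`. -/
def ValidValues (vmax : ℝ) (v : Fin k → ℝ) : Prop := ∀ i, 0 < v i ∧ v i ≤ vmax

/-- The regret of allocation rule `A` on the instance with CTRs `μ` and values `v`
(bids equal to the true values). -/
noncomputable def regret (A : Alloc k T) (μ v : Fin k → ℝ) : ℝ :=
  (T : ℝ) * (⨆ i : Fin k, μ i * v i) -
    ∑ ρ : Realization k T, prob μ ρ * ∑ t : Fin T, μ (A v ρ t) * v (A v ρ t)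

/-- The worst-case regret `R(T; vmax)`. -/
noncomputable def worstRegret (A : Alloc k T) (vmax : ℝ) : ℝ :=
  sSup {r : ℝ | ∃ μ v : Fin k → ℝ, ValidCTR μ ∧ ValidValues vmax v ∧ r = regret A μ v}

/-- The instance `(μ, v)` has `δ`-gap: the largest product `μ_i v_i` exceeds
the second largest by `δ · max_i v_i`. -/
def HasGap (μ v : Fin k → ℝ) (δ : ℝ) : Prop :=
  ∃ i : Fin k, (∀ j, μ j * v j ≤ μ i * v i) ∧
    μ i * v i - (⨆ j : {j : Fin k // j ≠ i}, μ j.1 * v j.1) = δ * (⨆ j : Fin k, v j)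

/-- The worst-case regret over `δ`-gap instances, `R_δ(T; vmax)`. -/
noncomputable def worstGapRegret (A : Alloc k T) (vmax δ : ℝ) : ℝ :=
  sSup {r : ℝ | ∃ μ v : Fin k → ℝ,
    ValidCTR μ ∧ ValidValues vmax v ∧ HasGap μ v δ ∧ r = regret A μ v}

/-- If `cf` and `cg` are subgradients of `f` and `g` on `[a, b]` and `cg + m ≤ cf` there, then
`f - g` grows by at least `m * (b - a)`. -/
theorem mul_sub_le_of_subgradient_le {f g cf cg : ℝ → ℝ} {a b m : ℝ} (hab : a ≤ b)
    (hf : ∀ x ∈ Set.Icc a b, ∀ y ∈ Set.Icc a b, (y - x) * cf x ≤ f y - f x)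
    (hg : ∀ x ∈ Set.Icc a b, ∀ y ∈ Set.Icc a b, (y - x) * cg x ≤ g y - g x)
    (h : ∀ x ∈ Set.Icc a b, cg x + m ≤ cf x) :
    m * (b - a) ≤ (f b - g b) - (f a - g a) := by
  have step : ∀ x ∈ Set.Icc a b, ∀ y ∈ Set.Icc a b, x ≤ y →
      (y - x) * (cg x - cg y) + m * (y - x) ≤ (f y - g y) - (f x - g x) := by
    intro x hx y hy hxy
    nlinarith [hf x hx y hy, hg y hy x hx, mul_le_mul_of_nonneg_left (h x hx) (sub_nonneg.2 hxy)]
  have sum_step : ∀ (δ : ℝ), 0 ≤ δ → ∀ n : ℕ, a + n * δ ≤ b →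
      δ * (cg a - cg (a + n * δ)) + m * (n * δ) ≤
        (f (a + n * δ) - g (a + n * δ)) - (f a - g a) := by
    intro δ hδ n
    induction n with
    | zero => simp
    | succ n ih =>
      intro hn
      push_cast at hn ⊢
      have hnδ : 0 ≤ n * δ := by positivity
      have := step (a + n * δ) ⟨by linarith, by linarith⟩ (a + (n + 1) * δ)
        ⟨by linarith, hn⟩ (by linarith)
      have e : a + (n + 1) * δ - (a + n * δ) = δ := by ring
      rw [e] at this
      linarith [ih (by linarith)]
  have lower : ∀ n : ℕ, (b - a) * (cg b - cg a) ≥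
      (n + 1) * (m * (b - a) - ((f b - g b) - (f a - g a))) := by
    intro n
    have hn : (0 : ℝ) < n + 1 := by positivity
    have e : a + ((n + 1 : ℕ) : ℝ) * ((b - a) / (n + 1)) = b := by
      push_cast; field_simp; ring
    have e' : ((n + 1 : ℕ) : ℝ) * ((b - a) / (n + 1)) = b - a := by linarith
    have := sum_step ((b - a) / (n + 1)) (div_nonneg (by linarith) hn.le) (n + 1) e.le
    rw [e, e'] at this
    have h2 := mul_le_mul_of_nonneg_left this hn.le
    have e2 : (n + 1) * ((b - a) / (n + 1) * (cg a - cg b) + m * (b - a)) =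
        (b - a) * (cg a - cg b) + (n + 1) * (m * (b - a)) := by field_simp
    rw [e2] at h2
    linarith
  by_contra! hlt
  obtain ⟨n, hn⟩ := exists_nat_gt
    ((b - a) * (cg b - cg a) / (m * (b - a) - ((f b - g b) - (f a - g a))))
  rw [div_lt_iff₀ (by linarith)] at hn
  linarith [lower n]

/-- The realization that agrees with `ρ` before round `t`, has no clicks after round `t`,
and at round `t` has a click only for agent `i`, and only if `c` holds. -/
def truncate (ρ : Realization k T) (t : Fin T) (i : Fin k) (c : Bool) : Realization k T :=
  fun j s => if s < t then ρ j s else c && decide (j = i ∧ s = t)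

theorem Online.truncate_eq {A : Alloc k T} (hA : Online A) (b : Fin k → ℝ) (ρ : Realization k T)
    (t s : Fin T) (i : Fin k) (c : Bool) (hs : s ≤ t) :
    A b (truncate ρ t i c) s = A b ρ s :=
  (hA b ρ _ s fun r hr => by simp [truncate, hr.trans_le hs]).symm

theorem Online.clicks_truncate {A : Alloc k T} (hA : Online A) (b : Fin k → ℝ)
    (ρ : Realization k T) (t : Fin T) (i : Fin k) :
    clicks A b (truncate ρ t i true) i =
      clicks A b (truncate ρ t i false) i + if A b ρ t = i then 1 else 0 := by
  have key : ∀ c s, (A b (truncate ρ t i c) s = i ∧ truncate ρ t i c i s = true) ↔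
      (s < t ∧ A b ρ s = i ∧ ρ i s = true) ∨ (s = t ∧ A b ρ t = i ∧ c = true) := by
    intro c s
    rcases lt_trichotomy s t with h | rfl | h
    · rw [hA.truncate_eq b ρ t s i c h.le]
      simp [truncate, h, h.ne]
    · rw [hA.truncate_eq b ρ s s i c le_rfl]
      simp [truncate]
    · simp [truncate, h.not_gt, h.ne']
  unfold clicks
  simp only [key]
  split_ifs with h
  · rw [← card_insert_of_notMem (a := t) (by simp)]
    congr 1
    ext s
    simp [h, or_comm]
  · simp [h]

theorem PaymentObservable.truncate_eq {A : Alloc k T} {P : Payment k T}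
    (hP : PaymentObservable A P) (hA : Online A) (b : Fin k → ℝ) (ρ : Realization k T)
    (t : Fin T) (i : Fin k) (h : A b ρ t ≠ i) :
    P b (truncate ρ t i true) = P b (truncate ρ t i false) := by
  refine hP b _ _ fun s => ?_
  by_cases hs : s = t
  · subst hs
    rw [hA.truncate_eq b ρ s s i true le_rfl]
    simp [truncate, h]
  · simp [truncate, hs]

/-- A normalized truthful mechanism with a non-degenerate deterministic
allocation rule has a pointwise monotone allocation rule. -/
theorem truthful_implies_pointwise_monotone (k T : ℕ) (A : Alloc k T) (P : Payment k T)
    (hOnline : Online A) (hND : NonDegenerate A)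
    (hObs : PaymentObservable A P) (hNorm : Normalized A P) (hTruth : Truthful A P) :
    PointwiseMonotone A := by
  intro b ρ t i x hb hbi hx
  by_contra hne
  have hpos : ∀ y : ℝ, 0 < y → PosBids (Function.update b i y) := by
    intro y hy j
    by_cases h : j = i
    · subst h; simpa using hy
    · simpa [h] using hb j
  let C (c : Bool) (y : ℝ) : ℝ := clicks A (Function.update b i y) (truncate ρ t i c) i
  let U (c : Bool) (y : ℝ) : ℝ := y * C c y - P (Function.update b i y) (truncate ρ t i c) i
  have hU : ∀ c, ∀ y z : ℝ, 0 < y → 0 < z → (z - y) * C c y ≤ U c z - U c y := by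
    intro c y z hy hz
    have := hTruth (Function.update b i y) (truncate ρ t i c) i z (hpos y hy) hz
    simp only [Function.update_idem] at this
    simp only [U, C]
    linarith
  have hC : ∀ y, C true y = C false y + if A (Function.update b i y) ρ t = i then 1 else 0 := by
    intro y
    simp only [C, hOnline.clicks_truncate]
    push_cast
    rfl
  have mono : ∀ y z, 0 < y → y ≤ z → U true y - U false y ≤ U true z - U false z := by
    intro y z hy hyz
    have := mul_sub_le_of_subgradient_le (m := 0) hyz
      (fun r hr s hs => hU true r s (hy.trans_le hr.1) (hy.trans_le hs.1))
      (fun r hr s hs => hU false r s (hy.trans_le hr.1) (hy.trans_le hs.1))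
      (fun r _ => by rw [hC]; split_ifs <;> simp)
    linarith
  obtain ⟨l, u, hlu, hl, hu, hI⟩ := hND b ρ t t hb le_rfl
  rw [hbi] at hl hu hI
  have hbi0 := hb i
  obtain ⟨p, hp⟩ : ∃ p, p = max l (b i / 2) := ⟨_, rfl⟩
  obtain ⟨q, hq⟩ : ∃ q, q = min u x := ⟨_, rfl⟩
  have hpl : l ≤ p := hp ▸ le_max_left _ _
  have hp0 : 0 < p := (half_pos hbi0).trans_le (hp ▸ le_max_right _ _)
  have hqu : q ≤ u := hq ▸ min_le_left _ _
  have hqx : q ≤ x := hq ▸ min_le_right _ _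
  have hpq : p < q := by
    rw [hp, hq, max_lt_iff, lt_min_iff, lt_min_iff]
    exact ⟨⟨hlu, by linarith⟩, by linarith, by linarith⟩
  have gain : 1 * (q - p) ≤ (U true q - U false q) - (U true p - U false p) := by
    refine mul_sub_le_of_subgradient_le hpq.le
      (fun r hr s hs => hU true r s (hp0.trans_le hr.1) (hp0.trans_le hs.1))
      (fun r hr s hs => hU false r s (hp0.trans_le hr.1) (hp0.trans_le hs.1)) fun r hr => ?_
    rw [hC, if_pos]
    exact (hI r ⟨hpl.trans hr.1, hr.2.trans hqu⟩ ρ (by simp) t (by simp)).2 hbi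
  have hUx : U true x = U false x := by
    simp only [U, hC x, if_neg hne, add_zero, hObs.truncate_eq hOnline _ ρ t i hne]
  obtain ⟨ε, hε⟩ : ∃ ε, ε = min p ((q - p) / (T + 2)) := ⟨_, rfl⟩
  have hT : (0 : ℝ) < T + 2 := by positivity
  have hε0 : 0 < ε := by
    rw [hε]
    exact lt_min hp0 (div_pos (by linarith) hT)
  have hεp : ε ≤ p := hε ▸ min_le_left _ _
  have hεq : ε * (T + 2) ≤ q - p := by
    rw [← le_div_iff₀ hT]
    exact hε ▸ min_le_right _ _
  have hlow : 0 ≤ U true ε := by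
    have := (hNorm _ (truncate ρ t i true) i (hpos ε hε0)).2
    rw [Function.update_self] at this
    exact sub_nonneg.2 this
  have hhigh : U false ε ≤ ε * T := by
    have h0 := (hNorm _ (truncate ρ t i false) i (hpos ε hε0)).1
    have hCT : C false ε ≤ T := by
      simp only [C, clicks]
      exact_mod_cast (card_filter_le _ _).trans (by simp)
    exact (sub_le_self _ h0).trans (mul_le_mul_of_nonneg_left hCT hε0.le)
  linarith [mono ε p hε0 hεp, mono q x (hp0.trans hpq) hqx]

end MAB
end

section
/- Consider the MAB mechanism design problem with exactly two agents (k = 2). Let A be a non-degenerate, scale-free deterministic allocation rule. If (A,P) is a normalized truthful mechanism for some payment rule P, then A is exploration-separated. -/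
open Finset

namespace MAB

variable {k T : ℕ}

/-- One step of the discrete envelope comparison of two indirect utilities `v * c v - p v`. -/
lemma utility_gap_mono {c c' p p' : ℝ → ℝ} {a b δ : ℝ} (ha : 0 < a) (hab : a ≤ b)
    (hT : ∀ v x, 0 < v → 0 < x → v * c x - p x ≤ v * c v - p v)
    (hT' : ∀ v x, 0 < v → 0 < x → v * c' x - p' x ≤ v * c' v - p' v)
    (hc : ∀ x ∈ Set.Icc a b, c x + δ ≤ c' x) :
    δ * (b - a) ≤ ((b * c' b - p' b) - (b * c b - p b)) -
      ((a * c' a - p' a) - (a * c a - p a)) := by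
  set D : ℝ → ℝ := fun v => (v * c' v - p' v) - (v * c v - p v) with hD
  have partition_bound : ∀ n : ℕ, δ * (b - a) ≤ D b - D a + (b - a) * (c b - c a) / (n + 1) := by
    intro n
    have hn : (0 : ℝ) < n + 1 := by positivity
    set d := (b - a) / (n + 1) with hd
    have hd0 : 0 ≤ d := div_nonneg (by linarith) hn.le
    have hdn : (n + 1) * d = b - a := by rw [hd]; field_simp
    have hsum : ∀ m : ℕ, m ≤ n + 1 →
        m * d * δ ≤ D (a + m * d) - D a + d * (c (a + m * d) - c a) := by
      intro m
      induction m with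
      | zero => intro _; simp
      | succ m ih =>
        intro hm
        have h1 := ih (by omega)
        have hmn : (m : ℝ) ≤ n := by exact_mod_cast (by omega : m ≤ n)
        have hm0 : 0 ≤ (m : ℝ) * d := by positivity
        have hmle : (m : ℝ) * d ≤ n * d := mul_le_mul_of_nonneg_right hmn hd0
        push_cast
        set x := a + m * d with hx
        have hx' : a + (m + 1) * d = x + d := by rw [hx]; ring
        rw [hx']
        have hx0 : 0 < x := by linarith
        have e1 := hT x (x + d) hx0 (by linarith)
        have e2 := hT' (x + d) x (by linarith) hx0
        have e3 := mul_le_mul_of_nonneg_left (hc x ⟨by linarith, by linarith⟩) hd0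
        simp only [hD] at h1 ⊢
        linarith
    have h := hsum (n + 1) le_rfl
    push_cast at h
    rw [hdn, show a + (b - a) = b by ring] at h
    calc δ * (b - a) = (b - a) * δ := mul_comm _ _
      _ ≤ _ := h
      _ = _ := by rw [hd]; ring
  change δ * (b - a) ≤ D b - D a
  have hlim : Filter.Tendsto
      (fun n : ℕ => D b - D a + (b - a) * (c b - c a) / ((n : ℝ) + 1))
      Filter.atTop (nhds (D b - D a + 0)) := by
    refine tendsto_const_nhds.add ?_
    have := tendsto_one_div_add_atTop_nhds_zero_nat (𝕜 := ℝ)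
    simpa [div_eq_mul_inv] using this.const_mul ((b - a) * (c b - c a))
  rw [add_zero] at hlim
  exact ge_of_tendsto' hlim partition_bound

lemma Online.eq_of_agree_before {A : Alloc k T} (hA : Online A) {b : Fin k → ℝ}
    {ρ ρ' : Realization k T} {t : Fin T} (h : ∀ j, ∀ s < t, ρ j s = ρ' j s) :
    A b ρ t = A b ρ' t :=
  hA b ρ ρ' t fun s hs => h _ s hs

lemma PosBids.update {b : Fin k → ℝ} (hb : PosBids b) (i : Fin k) {x : ℝ} (hx : 0 < x) :
    PosBids (Function.update b i x) := by
  intro j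
  by_cases h : j = i
  · subst h; simpa using hx
  · simpa [h] using hb j

/-- If a bid `y` of agent `i` observes no difference between `φ` and `φ'`, then `φ` cannot give
agent `i` at least as many clicks as `φ'` for all lower bids and strictly more on an interval. -/
lemma no_click_gap {A : Alloc k T} {P : Payment k T} (hOnline : Online A)
    (hObs : PaymentObservable A P) (hNorm : Normalized A P) (hTruth : Truthful A P)
    {b : Fin k → ℝ} (hb : PosBids b) {i : Fin k} {φ φ' : Realization k T} {l u y : ℝ}
    (hl : 0 < l) (hlu : l < u) (huy : u ≤ y)
    (hle : ∀ x, 0 < x →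
      clicks A (Function.update b i x) φ' i ≤ clicks A (Function.update b i x) φ i)
    (hlt : ∀ x ∈ Set.Icc l u,
      clicks A (Function.update b i x) φ' i < clicks A (Function.update b i x) φ i)
    (hy : ∀ s, φ (A (Function.update b i y) φ s) s = φ' (A (Function.update b i y) φ s) s) :
    False := by
  have hP := hObs _ _ _ hy
  have hAeq : ∀ s, A (Function.update b i y) φ s = A (Function.update b i y) φ' s :=
    fun s => hOnline _ _ _ s fun r _ => hy r
  have hC : clicks A (Function.update b i y) φ i = clicks A (Function.update b i y) φ' i := by
    unfold clicks
    congr 1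
    ext s
    simp only [mem_filter, mem_univ, true_and, ← hAeq s]
    constructor <;> rintro ⟨h, h'⟩ <;> refine ⟨h, ?_⟩ <;> have := hy s <;> simp_all
  let c : Realization k T → ℝ → ℝ := fun ψ x => clicks A (Function.update b i x) ψ i
  let p : Realization k T → ℝ → ℝ := fun ψ x => P (Function.update b i x) ψ i
  have hT : ∀ ψ v x, 0 < v → 0 < x → v * c ψ x - p ψ x ≤ v * c ψ v - p ψ v := by
    intro ψ v x hv hx
    simpa using hTruth (Function.update b i x) ψ i v (hb.update i hx) hv
  have hmono : ∀ a e, 0 < a → a ≤ e →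
      0 * (e - a) ≤ ((e * c φ e - p φ e) - (e * c φ' e - p φ' e)) -
        ((a * c φ a - p φ a) - (a * c φ' a - p φ' a)) := fun a e ha hae =>
    utility_gap_mono ha hae (hT φ') (hT φ)
      fun x hx => by simpa [c] using hle x (ha.trans_le hx.1)
  have hgap := utility_gap_mono (δ := 1) hl hlu.le (hT φ') (hT φ)
    fun x hx => by simp only [c]; exact_mod_cast hlt x hx
  have huse := hmono u y (hl.trans hlu) huy
  have hcy : c φ y = c φ' y := by simp only [c, hC]
  have hpy : p φ y = p φ' y := by simp only [p, hP]
  rw [hcy, hpy] at huse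
  have hT0 : (0 : ℝ) < T + 1 := by positivity
  set a := min l ((u - l) / (2 * (T + 1))) with hadef
  have ha : 0 < a := lt_min hl (div_pos (by linarith) (by positivity))
  have haT : a * (T + 1) ≤ (u - l) / 2 := by
    calc a * (T + 1) ≤ (u - l) / (2 * (T + 1)) * (T + 1) :=
          mul_le_mul_of_nonneg_right (min_le_right _ _) hT0.le
      _ = (u - l) / 2 := by field_simp
  have hlow := hmono a l ha (min_le_left _ _)
  have hN := (hNorm (Function.update b i a) φ i (hb.update i ha)).2
  have hN' := (hNorm (Function.update b i a) φ' i (hb.update i ha)).1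
  rw [Function.update_self] at hN
  have hbound : c φ' a ≤ T := by
    have : clicks A (Function.update b i a) φ' i ≤ T := by
      simpa [clicks] using card_filter_le (univ : Finset (Fin T)) _
    simpa only [c] using Nat.cast_le.2 this
  have hbound' := mul_le_mul_of_nonneg_left hbound ha.le
  simp only [c, p] at *
  linarith

lemma pointwiseMonotone_of_truthful {A : Alloc k T} {P : Payment k T} (hOnline : Online A)
    (hND : NonDegenerate A) (hObs : PaymentObservable A P) (hNorm : Normalized A P)
    (hTruth : Truthful A P) : PointwiseMonotone A := by
  intro b ρ t i y hb hi hy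
  by_contra hne
  let φ : Realization k T := fun j s => if s < t then ρ j s else decide (s = t ∧ j = i)
  let φ' : Realization k T := fun j s => if s < t then ρ j s else false
  have hφ : ∀ b', A b' φ t = A b' ρ t := fun b' =>
    hOnline.eq_of_agree_before fun j s hs => by simp [φ, hs]
  have hφφ' : ∀ b', ∀ s ≤ t, A b' φ s = A b' φ' s := fun b' s hst =>
    hOnline.eq_of_agree_before fun j r hr => by simp [φ, φ', hr.trans_le hst]
  have hsub : ∀ b', (univ.filter fun s : Fin T => A b' φ' s = i ∧ φ' i s = true) ⊆
      (univ.filter fun s : Fin T => A b' φ s = i ∧ φ i s = true) := by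
    intro b' s
    simp only [mem_filter, mem_univ, true_and]
    rintro ⟨h, h'⟩
    have hs : s < t := by by_contra hs; simp [φ', hs] at h'
    refine ⟨(hφφ' b' s hs.le).trans h, ?_⟩
    simpa [φ, φ', hs] using h'
  have hbi : A b φ t = i := (hφ b).trans hi
  obtain ⟨l, u, hlu, hlb, hbu, hI⟩ := hND b φ t t hb le_rfl
  rw [hbi] at hlb hbu hI
  have hpos := hb i
  refine no_click_gap hOnline hObs hNorm hTruth hb (i := i) (φ := φ) (φ' := φ')
    (l := max l (b i / 2)) (u := min u y) (y := y) (lt_max_of_lt_right (by linarith))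
    (by simp only [max_lt_iff, lt_min_iff]; refine ⟨⟨?_, ?_⟩, ?_, ?_⟩ <;> linarith)
    (min_le_right _ _) (fun x _ => card_le_card (hsub _)) ?_ ?_
  · intro x hx
    refine card_lt_card (ssubset_def.2 ⟨hsub _, fun h => ?_⟩)
    have hA : A (Function.update b i x) φ t = i :=
      (hI x ⟨(le_max_left _ _).trans hx.1, hx.2.trans (min_le_left _ _)⟩ φ (by simp) t
        (by simp)).2 hbi
    have := h (mem_filter.2 ⟨mem_univ t, hA, by simp [φ]⟩)
    simp [φ'] at this
  · intro s
    rcases lt_trichotomy s t with hs | rfl | hs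
    · simp [φ, φ', hs]
    · have : A (Function.update b i y) φ s ≠ i := by rwa [hφ]
      simpa [φ, φ'] using this
    · simp [φ, φ', hs.not_gt, hs.ne']

/-- If `φ` and `φ'` lead to the same allocation before round `t`, and to clicks of agent `i` in
round `t` that differ on an interval of bids below `y`, then the bid `y` observes a difference. -/
lemma observes_difference {A : Alloc k T} {P : Payment k T} (hOnline : Online A)
    (hMono : PointwiseMonotone A) (hObs : PaymentObservable A P) (hNorm : Normalized A P)
    (hTruth : Truthful A P) {b : Fin k → ℝ} (hb : PosBids b) {i : Fin k}
    {φ φ' : Realization k T} {t : Fin T} {l u y : ℝ}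
    (hl : 0 < l) (hlu : l < u) (huy : u ≤ y)
    (hbit : ∀ s, φ i s = φ' i s) (hafter : ∀ s, t < s → φ i s = false) (hnow : φ i t = true)
    (heq : ∀ x, 0 < x → ∀ s < t,
      A (Function.update b i x) φ s = A (Function.update b i x) φ' s)
    (hφ : ∀ x ∈ Set.Icc l u, A (Function.update b i x) φ t = i)
    (hφ' : ∀ x ∈ Set.Icc l u, A (Function.update b i x) φ' t ≠ i)
    (hy : ∀ s, φ (A (Function.update b i y) φ s) s = φ' (A (Function.update b i y) φ s) s) :
    False := by
  have hmono : ∀ ψ x z, 0 < x → x ≤ z → A (Function.update b i x) ψ t = i →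
      A (Function.update b i z) ψ t = i := by
    intro ψ x z hx hxz h
    rcases hxz.eq_or_lt with rfl | hxz
    · exact h
    · simpa using hMono (Function.update b i x) ψ t i z (hb.update i hx) h (by simpa using hxz)
  have himp : ∀ x, 0 < x → A (Function.update b i x) φ' t = i →
      A (Function.update b i x) φ t = i := by
    intro x hx h
    rcases le_total l x with hlx | hxl
    · exact hmono φ l x hl hlx (hφ l ⟨le_rfl, hlu.le⟩)
    · exact absurd (hmono φ' x l hx hxl h) (hφ' l ⟨le_rfl, hlu.le⟩)
  have hsub : ∀ x, 0 < x →
      (univ.filter fun s : Fin T => A (Function.update b i x) φ' s = i ∧ φ' i s = true) ⊆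
      (univ.filter fun s : Fin T => A (Function.update b i x) φ s = i ∧ φ i s = true) := by
    intro x hx s
    simp only [mem_filter, mem_univ, true_and]
    rintro ⟨h, h'⟩
    rw [← hbit] at h'
    refine ⟨?_, h'⟩
    rcases lt_trichotomy s t with hs | rfl | hs
    · exact (heq x hx s hs).trans h
    · exact himp x hx h
    · simp [hafter s hs] at h'
  refine no_click_gap hOnline hObs hNorm hTruth hb hl hlu huy
    (fun x hx => card_le_card (hsub x hx)) (fun x hx => ?_) hy
  refine card_lt_card (ssubset_def.2 ⟨hsub x (hl.trans_le hx.1), fun h => ?_⟩)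
  have := h (mem_filter.2 ⟨mem_univ t, hφ x hx, hnow⟩)
  simp [hφ' x hx] at this

lemma ScaleFree.eq_update {A : Alloc 2 T} (hSF : ScaleFree A) {b b' : Fin 2 → ℝ}
    (hb : PosBids b) (hb' : PosBids b') {i j : Fin 2} (hij : i ≠ j)
    (ρ : Realization 2 T) (t : Fin T) :
    A b' ρ t = A (Function.update b i (b' i * b j / b' j)) ρ t := by
  rw [← hSF (b j / b' j) b' ρ t (div_pos (hb j) (hb' j)) hb']
  congr 1
  funext m
  have := (hb' j).ne'
  by_cases hm : m = i
  · subst hm; rw [Function.update_self]; ring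
  · have hmj : m = j := by omega
    subst hmj; rw [Function.update_of_ne hm]; field_simp

lemma flip_apply_of_ne {ρ : Realization k T} {j m : Fin k} {t s : Fin T}
    (h : m ≠ j ∨ s ≠ t) : flip ρ j t m s = ρ m s := by
  unfold flip; grind

/-- A round whose allocation depends on the bids has no influence on later rounds. -/
lemma not_influential_of_bid_dependent {A : Alloc 2 T} {P : Payment 2 T} (hOnline : Online A)
    (hND : NonDegenerate A) (hSF : ScaleFree A) (hObs : PaymentObservable A P)
    (hNorm : Normalized A P) (hTruth : Truthful A P) (t t' : Fin T) (htt' : t < t')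
    (ρ : Realization 2 T) (b b' : Fin 2 → ℝ) (hb : PosBids b) (hb' : PosBids b')
    (hne : A b' ρ t ≠ A b ρ t) : A b ρ t' = A b (flip ρ (A b ρ t) t) t' := by
  have hMono := pointwiseMonotone_of_truthful hOnline hND hObs hNorm hTruth
  induction t' using WellFoundedLT.induction generalizing ρ b b' with
  | ind t' ih =>
  by_contra hinf
  obtain ⟨i, hi⟩ : ∃ i, A b' ρ t = i := ⟨_, rfl⟩
  obtain ⟨j, hj⟩ : ∃ j, A b ρ t = j := ⟨_, rfl⟩
  rw [hj] at hinf
  rw [hi, hj] at hne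
  have hnei : ∀ m : Fin 2, m ≠ i ↔ m = j := by omega
  set y := b' i * b j / b' j with hydef
  have hy0 : 0 < y := div_pos (mul_pos (hb' i) (hb j)) (hb' j)
  have hAy : A (Function.update b i y) ρ t = i := by
    rw [← hSF.eq_update hb hb' hne, hi]
  have hby : b i < y := by
    by_contra! hle
    have : A b ρ t = i := by
      rcases hle.eq_or_lt with h | h
      · rwa [h, Function.update_eq_self] at hAy
      · simpa using
          hMono (Function.update b i y) ρ t i (b i) (hb.update i hy0) hAy (by simpa using h)
    exact hne (this.symm.trans hj)
  let σ : Realization 2 T := fun m s => if s < t' then ρ m s else decide (s = t')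
  have hσ : ∀ c, ∀ s ≤ t', A c σ s = A c ρ s := fun c s hs =>
    hOnline.eq_of_agree_before fun m r hr => by simp [σ, hr.trans_le hs]
  have hσ' : ∀ c, A c (flip σ j t) t' = A c (flip ρ j t) t' := fun c =>
    hOnline.eq_of_agree_before fun m r hr => by simp [flip, σ, hr]
  have hσj : A b σ t = j := (hσ b t htt'.le).trans hj
  have hσb' : A b' σ t = i := (hσ b' t htt'.le).trans hi
  have hσy : A (Function.update b i y) σ t = i := (hσ _ t htt'.le).trans hAy
  rw [← hσ b t' le_rfl, ← hσ' b] at hinf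
  have hunseen : ∀ c, A c σ t = i → ∀ s, σ (A c σ s) s = flip σ j t (A c σ s) s := by
    intro c hc s
    refine (flip_apply_of_ne ?_).symm
    by_cases hs : s = t
    · subst hs; left; rwa [hc]
    · exact Or.inr hs
  have heq : ∀ x, 0 < x → ∀ s < t',
      A (Function.update b i x) σ s = A (Function.update b i x) (flip σ j t) s := by
    intro x hx s hs
    by_cases hc : A (Function.update b i x) σ t = i
    · exact hOnline _ _ _ s fun r _ => hunseen _ hc r
    · rcases lt_or_ge t s with hts | hst
      · have h := ih s hs hts σ (Function.update b i x) b' (hb.update i hx) hb'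
          (by rw [hσb']; exact Ne.symm hc)
        rwa [(hnei _).1 hc] at h
      · exact hOnline.eq_of_agree_before fun m r hr =>
          (flip_apply_of_ne (Or.inr (hr.trans_le hst).ne)).symm
  obtain ⟨l, u, hlu, hlb, hbu, hI⟩ := hND b σ t t' hb htt'.le
  rw [hσj] at hlb hbu hI
  have hbi := hb i
  have hbj := hb j
  have hu : 0 < u := hbj.trans_le hbu
  have hl' : 0 < max l (b j / 2) := lt_max_of_lt_right (by linarith)
  have hl'u : max l (b j / 2) < u := max_lt hlu (by linarith)
  have hprod : 0 < b i * b j := mul_pos hbi hbj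
  have hL : 0 < b i * b j / u := div_pos hprod hu
  have hLU : b i * b j / u < min (b i * b j / max l (b j / 2)) y := by
    refine lt_min (div_lt_div_of_pos_left hprod hl' hl'u) (lt_of_le_of_lt ?_ hby)
    rw [div_le_iff₀ hu]
    exact mul_le_mul_of_nonneg_left hbu hbi.le
  have hstable : ∀ x ∈ Set.Icc (b i * b j / u) (min (b i * b j / max l (b j / 2)) y),
      ∀ φ ∈ ({σ, flip σ j t} : Set (Realization 2 T)),
        (A (Function.update b i x) φ t' = j ↔ A b φ t' = j) := by
    intro x hx φ hφ
    have hx0 : 0 < x := hL.trans_le hx.1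
    rw [hSF.eq_update hb (hb.update i hx0) hne.symm, Function.update_self,
      Function.update_of_ne hne.symm]
    refine hI _ ⟨?_, ?_⟩ φ hφ t' (by simp)
    · refine (le_max_left l (b j / 2)).trans ?_
      have := (le_div_iff₀ hl').1 (hx.2.trans (min_le_left _ _))
      rw [le_div_iff₀ hx0]
      linarith
    · have := (div_le_iff₀ hu).1 hx.1
      rw [div_le_iff₀ hx0]
      linarith
  have hstable_i : ∀ x ∈ Set.Icc (b i * b j / u) (min (b i * b j / max l (b j / 2)) y),
      ∀ φ ∈ ({σ, flip σ j t} : Set (Realization 2 T)),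
        (A (Function.update b i x) φ t' = i ↔ A b φ t' = i) := by
    intro x hx φ hφ
    have := hstable x hx φ hφ
    rw [← hnei, ← hnei] at this
    exact not_iff_not.1 this
  have hbit : ∀ s, flip σ j t i s = σ i s := fun s => flip_apply_of_ne (Or.inl hne)
  have hafter : ∀ s, t' < s → σ i s = false := fun s hs => by
    simp [σ, hs.not_gt, hs.ne']
  have hnow : σ i t' = true := by simp [σ]
  have hseen := hunseen _ hσy
  by_cases hcase : A b σ t' = i
  · exact observes_difference hOnline hMono hObs hNorm hTruth hb hL hLU (min_le_right _ _)
      (fun s => (hbit s).symm) hafter hnow heq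
      (fun x hx => (hstable_i x hx σ (by simp)).2 hcase)
      (fun x hx h => hinf (hcase.trans ((hstable_i x hx _ (by simp)).1 h).symm)) hseen
  · have hcase' : A b (flip σ j t) t' = i := by
      by_contra h
      exact hinf (((hnei _).1 hcase).trans ((hnei _).1 h).symm)
    refine observes_difference hOnline hMono hObs hNorm hTruth hb hL hLU (min_le_right _ _)
      hbit (fun s hs => (hbit s).trans (hafter s hs)) ((hbit t').trans hnow)
      (fun x hx s hs => (heq x hx s hs).symm)
      (fun x hx => (hstable_i x hx _ (by simp)).2 hcase')
      (fun x hx h => hcase ((hstable_i x hx σ (by simp)).1 h)) fun s => ?_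
    rw [← hOnline _ _ _ s fun r _ => hseen r]
    exact (hseen s).symm

/-- For two agents: if `A` is a non-degenerate scale-free deterministic
allocation rule and `(A,P)` is a normalized truthful mechanism for some payment rule `P`,
then `A` is exploration-separated. -/
theorem two_agents_truthful_implies_exploration_separated (T : ℕ) (A : Alloc 2 T)
    (P : Payment 2 T) (hOnline : Online A) (hND : NonDegenerate A) (hSF : ScaleFree A)
    (hObs : PaymentObservable A P) (hNorm : Normalized A P) (hTruth : Truthful A P) :
    ExplorationSeparated A := by
  intro ρ t ⟨b₀, hb₀, t', htt', hinf⟩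
  have h : ∀ b, PosBids b → A b ρ t = A b₀ ρ t := fun b hb => by
    by_contra hne
    exact hinf (not_influential_of_bid_dependent hOnline hND hSF hObs hNorm hTruth t t' htt'
      ρ b₀ b hb₀ hb hne)
  intro b b' hb hb'
  rw [h b hb, h b' hb']

end MAB
end
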